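/- For every h-normal Γ-linear connection of Cartan type and every family of smooth functions X^i of (t, x, y), typed as a d-tensor with a single upper spatial index, the following local Ricci identities hold for all indices i, j, k: (X^i_/1)_|k − (X^i_|k)_/1 = X^r R^i_r1k − X^i_|r T^r_1k − X^i|_(r) Rv^r_1k; (X^i_|j)_|k − (X^i_|k)_|j = X^r R^i_rjk − X^i|_(r) Rv^r_jk; (X^i_/1)|_(k) − (X^i|_(k))_/1 = X^r P^i_r1(k) − X^i|_(r) Pv^r_1k; (X^i_|j)|_(k) − (X^i|_(k))_|j = X^r P^i_rj(k) − X^i_|r C^r_jk − X^i|_(r) Pv^r_jk; (X^i|_(j))|_(k) − (X^i|_(k))|_(j) = X^r S^i_r(j)(k). -/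

import Mathlib

open Finset

noncomputable section

namespace Jet

/-- Smooth real-valued functions of `(t, x, y) ∈ ℝ × ℝⁿ × ℝⁿ`, the local coordinates
of the 1-jet space `J¹(ℝ, M)`. -/
abbrev Fn (n : ℕ) : Type := ℝ → (Fin n → ℝ) → (Fin n → ℝ) → ℝ

def Smooth {n : ℕ} (F : Fn n) : Prop :=
  ContDiff ℝ (⊤ : ℕ∞) (fun p : ℝ × (Fin n → ℝ) × (Fin n → ℝ) => F p.1 p.2.1 p.2.2)

/-- Partial derivative in the time variable `t`. -/
def pt {n : ℕ} (F : Fn n) : Fn n := fun t x y => deriv (fun s => F s x y) t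

/-- Partial derivative in the spatial variable `xⁱ`. -/
def px {n : ℕ} (i : Fin n) (F : Fn n) : Fn n :=
  fun t x y => deriv (fun s => F t (Function.update x i s) y) (x i)

/-- Partial derivative in the fibre variable `yⁱ`. -/
def py {n : ℕ} (i : Fin n) (F : Fn n) : Fn n :=
  fun t x y => deriv (fun s => F t x (Function.update y i s)) (y i)

/-- Kronecker delta, as a constant function on the jet space. -/
def kron {n : ℕ} (i j : Fin n) : Fn n := if i = j then 1 else 0

/-- The coordinate function `yⁱ`. -/
def yc {n : ℕ} (i : Fin n) : Fn n := fun _ _ y => y i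

/-- The Christoffel symbol `κ(t) = (1/(2h)) dh/dt` of a Riemannian metric `h` on `ℝ`,
as a function on the jet space. -/
def chr {n : ℕ} (h : ℝ → ℝ) : Fn n := fun t _ _ => deriv h t / (2 * h t)

/-- The metric `h(t)` as a function on the jet space. -/
def hfun {n : ℕ} (h : ℝ → ℝ) : Fn n := fun t _ _ => h t

/-- The derivative `dh/dt` as a function on the jet space. -/
def hder {n : ℕ} (h : ℝ → ℝ) : Fn n := fun t _ _ => deriv h t

variable {n : ℕ}

/-- The adapted temporal derivative `δ/δt = ∂/∂t − Mʳ ∂/∂yʳ` determined by a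
nonlinear connection `(M, N)`. -/
def dt (M : Fin n → Fn n) (F : Fn n) : Fn n := pt F - ∑ r, M r * py r F

/-- The adapted spatial derivative `δ/δxᵏ = ∂/∂xᵏ − Nʳₖ ∂/∂yʳ`. -/
def dx (N : Fin n → Fin n → Fn n) (k : Fin n) (F : Fn n) : Fn n :=
  px k F - ∑ r, N r k * py r F

/-- An `h`-normal `Γ`-linear connection `(κ, Gᵏᵢ, Lᵏᵢⱼ, Cᵏᵢⱼ)`. -/
structure Conn (n : ℕ) where
  κ : Fn n
  G : Fin n → Fin n → Fn n
  L : Fin n → Fin n → Fin n → Fn n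
  C : Fin n → Fin n → Fin n → Fn n

/-! ### Torsion d-tensors -/

/-- `Tʳ₁ⱼ = −Gʳⱼ`. -/
def T1 (Γ : Conn n) (r j : Fin n) : Fn n := -Γ.G r j

/-- `Rvʳ₁ⱼ = (δ/δxʲ)Mʳ − (δ/δt)Nʳⱼ`. -/
def Rv1 (M : Fin n → Fn n) (N : Fin n → Fin n → Fn n) (r j : Fin n) : Fn n :=
  dx N j (M r) - dt M (N r j)

/-- `Tʳᵢⱼ = Lʳᵢⱼ − Lʳⱼᵢ`. -/
def Tsp (Γ : Conn n) (r i j : Fin n) : Fn n := Γ.L r i j - Γ.L r j i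

/-- `Rvʳᵢⱼ = (δ/δxʲ)Nʳᵢ − (δ/δxⁱ)Nʳⱼ`. -/
def Rvsp (M : Fin n → Fn n) (N : Fin n → Fin n → Fn n) (r i j : Fin n) : Fn n :=
  dx N j (N r i) - dx N i (N r j)

/-- `Pvʳ₁ⱼ = ∂Mʳ/∂yʲ − Gʳⱼ + δʳⱼ κ`. -/
def Pv1 (M : Fin n → Fn n) (Γ : Conn n) (r j : Fin n) : Fn n :=
  py j (M r) - Γ.G r j + kron r j * Γ.κ

/-- `Phʳᵢⱼ = Cʳᵢⱼ`. -/
def Phsp (Γ : Conn n) (r i j : Fin n) : Fn n := Γ.C r i j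

/-- `Pvʳᵢⱼ = ∂Nʳᵢ/∂yʲ − Lʳⱼᵢ`. -/
def Pvsp (N : Fin n → Fin n → Fn n) (Γ : Conn n) (r i j : Fin n) : Fn n :=
  py j (N r i) - Γ.L r j i

/-- `Sʳᵢⱼ = Cʳᵢⱼ − Cʳⱼᵢ`. -/
def Ssp (Γ : Conn n) (r i j : Fin n) : Fn n := Γ.C r i j - Γ.C r j i

/-! ### Generic covariant derivatives of d-tensors -/

/-- Index types of the (valued) indices of a d-tensor: upper/lower spatial,
upper/lower vertical.  (Temporal indices carry no value; they are accounted for by the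
temporal weight `p` = number of upper temporal indices minus number of lower temporal
indices.) -/
inductive IdxType | uS | lS | uV | lV

/-- A d-tensor component family with `m` valued indices. -/
abbrev Tensor (n m : ℕ) := (Fin m → Fin n) → Fn n

/-- The `ℝ`-horizontal covariant derivative `D_{/1}` of a d-tensor `D` with valued index
signature `σ` and temporal weight `p`. -/
def covT {m : ℕ} (M : Fin n → Fn n) (Γ : Conn n) (p : ℤ) (σ : Fin m → IdxType)
    (D : Tensor n m) : Tensor n m := fun a =>
  dt M (D a) + p • (Γ.κ * D a)
    + ∑ q : Fin m,
      (match σ q with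
      | .uS => ∑ r, D (Function.update a q r) * Γ.G (a q) r
      | .lS => -∑ r, D (Function.update a q r) * Γ.G r (a q)
      | .uV => ∑ r, D (Function.update a q r) * (Γ.G (a q) r - kron (a q) r * Γ.κ)
      | .lV => -∑ r, D (Function.update a q r) * (Γ.G r (a q) - kron r (a q) * Γ.κ) : Fn n)

/-- The `M`-horizontal covariant derivative `D_{|k}`. -/
def covX {m : ℕ} (N : Fin n → Fin n → Fn n) (Γ : Conn n) (σ : Fin m → IdxType)
    (k : Fin n) (D : Tensor n m) : Tensor n m := fun a =>
  dx N k (D a)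
    + ∑ q : Fin m,
      (match σ q with
      | .uS => ∑ r, D (Function.update a q r) * Γ.L (a q) r k
      | .uV => ∑ r, D (Function.update a q r) * Γ.L (a q) r k
      | .lS => -∑ r, D (Function.update a q r) * Γ.L r (a q) k
      | .lV => -∑ r, D (Function.update a q r) * Γ.L r (a q) k : Fn n)

/-- The vertical covariant derivative `D|_{(k)}`. -/
def covY {m : ℕ} (Γ : Conn n) (σ : Fin m → IdxType)
    (k : Fin n) (D : Tensor n m) : Tensor n m := fun a =>
  py k (D a)
    + ∑ q : Fin m,
      (match σ q with
      | .uS => ∑ r, D (Function.update a q r) * Γ.C (a q) r k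
      | .uV => ∑ r, D (Function.update a q r) * Γ.C (a q) r k
      | .lS => -∑ r, D (Function.update a q r) * Γ.C r (a q) k
      | .lV => -∑ r, D (Function.update a q r) * Γ.C r (a q) k : Fn n)

/-- The coefficients `Cᵏᵢⱼ` viewed as a d-tensor with signature
(upper spatial, lower spatial, lower vertical). -/
def CT (Γ : Conn n) : Tensor n 3 := fun a => Γ.C (a 0) (a 1) (a 2)

/-- The signature of `Cᵏᵢⱼ`. -/
def sigC : Fin 3 → IdxType := ![IdxType.uS, IdxType.lS, IdxType.lV]

/-! ### Curvature d-tensors -/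

/-- `Rˡᵢ₁ₖ`. -/
def Rc1 (M : Fin n → Fn n) (N : Fin n → Fin n → Fn n) (Γ : Conn n) (l i k : Fin n) : Fn n :=
  dx N k (Γ.G l i) - dt M (Γ.L l i k) + ∑ r, Γ.G r i * Γ.L l r k
    - ∑ r, Γ.L r i k * Γ.G l r + ∑ r, Γ.C l i r * Rv1 M N r k

/-- `Rˡᵢⱼₖ`. -/
def Rc (M : Fin n → Fn n) (N : Fin n → Fin n → Fn n) (Γ : Conn n) (l i j k : Fin n) : Fn n :=
  dx N k (Γ.L l i j) - dx N j (Γ.L l i k) + ∑ r, Γ.L r i j * Γ.L l r k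
    - ∑ r, Γ.L r i k * Γ.L l r j + ∑ r, Γ.C l i r * Rvsp M N r j k

/-- `Pˡᵢ₁₍ₖ₎`. -/
def Pc1 (M : Fin n → Fn n) (N : Fin n → Fin n → Fn n) (Γ : Conn n) (l i k : Fin n) : Fn n :=
  py k (Γ.G l i) - covT M Γ 0 sigC (CT Γ) ![l, i, k] + ∑ r, Γ.C l i r * Pv1 M Γ r k

/-- `Pˡᵢⱼ₍ₖ₎`. -/
def Pc (M : Fin n → Fn n) (N : Fin n → Fin n → Fn n) (Γ : Conn n) (l i j k : Fin n) : Fn n :=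
  py k (Γ.L l i j) - covX N Γ sigC j (CT Γ) ![l, i, k] + ∑ r, Γ.C l i r * Pvsp N Γ r j k

/-- `Sˡᵢ₍ⱼ₎₍ₖ₎`. -/
def Sc (Γ : Conn n) (l i j k : Fin n) : Fn n :=
  py k (Γ.C l i j) - py j (Γ.C l i k)
    + ∑ r, Γ.C r i j * Γ.C l r k - ∑ r, Γ.C r i k * Γ.C l r j

end Jet

namespace Jet

variable {n : ℕ}

/-- A family with one valued index, viewed as a d-tensor. -/
def famT (X : Fin n → Fn n) : Tensor n 1 := fun a => X (a 0)

def T1T (Γ : Conn n) : Tensor n 2 := fun a => T1 Γ (a 0) (a 1)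
def Rv1T (M : Fin n → Fn n) (N : Fin n → Fin n → Fn n) : Tensor n 2 :=
  fun a => Rv1 M N (a 0) (a 1)
def RvspT (M : Fin n → Fn n) (N : Fin n → Fin n → Fn n) : Tensor n 3 :=
  fun a => Rvsp M N (a 0) (a 1) (a 2)
def Pv1T (M : Fin n → Fn n) (Γ : Conn n) : Tensor n 2 := fun a => Pv1 M Γ (a 0) (a 1)
def PvspT (N : Fin n → Fin n → Fn n) (Γ : Conn n) : Tensor n 3 :=
  fun a => Pvsp N Γ (a 0) (a 1) (a 2)
def Rc1T (M : Fin n → Fn n) (N : Fin n → Fin n → Fn n) (Γ : Conn n) : Tensor n 3 :=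
  fun a => Rc1 M N Γ (a 0) (a 1) (a 2)
def RcT (M : Fin n → Fn n) (N : Fin n → Fin n → Fn n) (Γ : Conn n) : Tensor n 4 :=
  fun a => Rc M N Γ (a 0) (a 1) (a 2) (a 3)
def Pc1T (M : Fin n → Fn n) (N : Fin n → Fin n → Fn n) (Γ : Conn n) : Tensor n 3 :=
  fun a => Pc1 M N Γ (a 0) (a 1) (a 2)
def PcT (M : Fin n → Fn n) (N : Fin n → Fin n → Fn n) (Γ : Conn n) : Tensor n 4 :=
  fun a => Pc M N Γ (a 0) (a 1) (a 2) (a 3)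
def ScT (Γ : Conn n) : Tensor n 4 := fun a => Sc Γ (a 0) (a 1) (a 2) (a 3)

/-- valued-index signatures (temporal indices are tracked by the weight `p` only) -/
def sig0 : Fin 0 → IdxType := ![]
def siglS : Fin 1 → IdxType := ![IdxType.lS]
def siglV : Fin 1 → IdxType := ![IdxType.lV]
def sigU : Fin 1 → IdxType := ![IdxType.uS]
def sigV : Fin 1 → IdxType := ![IdxType.uV]
def sigUlS : Fin 2 → IdxType := ![IdxType.uS, IdxType.lS]
def sigUlV : Fin 2 → IdxType := ![IdxType.uS, IdxType.lV]
def sigVlS : Fin 2 → IdxType := ![IdxType.uV, IdxType.lS]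
def sigVlV : Fin 2 → IdxType := ![IdxType.uV, IdxType.lV]
def sigRvsp : Fin 3 → IdxType := ![IdxType.uV, IdxType.lS, IdxType.lS]
def sigPvsp : Fin 3 → IdxType := ![IdxType.uV, IdxType.lS, IdxType.lV]
def sigRc1 : Fin 3 → IdxType := ![IdxType.uS, IdxType.lS, IdxType.lS]
def sigRc : Fin 4 → IdxType := ![IdxType.uS, IdxType.lS, IdxType.lS, IdxType.lS]
def sigPc1 : Fin 3 → IdxType := ![IdxType.uS, IdxType.lS, IdxType.lV]
def sigPc : Fin 4 → IdxType := ![IdxType.uS, IdxType.lS, IdxType.lS, IdxType.lV]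
def sigSc : Fin 4 → IdxType := ![IdxType.uS, IdxType.lS, IdxType.lV, IdxType.lV]

end Jet
namespace Jet

variable {n : ℕ}

/-! ### Smooth functions and directional derivatives -/

lemma Smooth.zero : Smooth (0 : Fn n) := contDiff_const

lemma Smooth.add {F G : Fn n} (hF : Smooth F) (hG : Smooth G) : Smooth (F + G) :=
  ContDiff.add hF hG

lemma Smooth.sub {F G : Fn n} (hF : Smooth F) (hG : Smooth G) : Smooth (F - G) :=
  ContDiff.sub hF hG

lemma Smooth.mul {F G : Fn n} (hF : Smooth F) (hG : Smooth G) : Smooth (F * G) :=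
  ContDiff.mul hF hG

lemma Smooth.sum {ι : Type*} (s : Finset ι) {F : ι → Fn n} (hF : ∀ i, Smooth (F i)) :
    Smooth (∑ i ∈ s, F i) := by
  classical
  induction s using Finset.induction_on with
  | empty => simpa using Smooth.zero
  | insert a s ha ih => rw [sum_insert ha]; exact (hF a).add ih

/-- The coordinate space of the 1-jet space. -/
abbrev Pt (n : ℕ) : Type := ℝ × (Fin n → ℝ) × (Fin n → ℝ)

/-- A function on the jet space as a function of a single point. -/
def unc (F : Fn n) : Pt n → ℝ := fun p => F p.1 p.2.1 p.2.2

/-- The derivative of `F` in the constant direction `v`. -/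
def dirD (v : Pt n) (F : Fn n) : Fn n := fun t x y => fderiv ℝ (unc F) (t, x, y) v

lemma Smooth.differentiable {F : Fn n} (hF : Smooth F) : Differentiable ℝ (unc F) :=
  ContDiff.differentiable hF (by simp)

lemma smooth_dirD (v : Pt n) {F : Fn n} (hF : Smooth F) : Smooth (dirD v F) := by
  have h : ContDiff ℝ (⊤ : ℕ∞) (unc F) := hF
  exact (h.fderiv_right (m := (⊤ : ℕ∞)) (by simp)).clm_apply contDiff_const

lemma dirD_comm (v w : Pt n) {F : Fn n} (hF : Smooth F) :
    dirD v (dirD w F) = dirD w (dirD v F) := by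
  have h : ContDiff ℝ (⊤ : ℕ∞) (unc F) := hF
  have hd : Differentiable ℝ (fderiv ℝ (unc F)) :=
    (h.fderiv_right (m := (⊤ : ℕ∞)) (by simp)).differentiable (by simp)
  have key : ∀ (v w : Pt n) (p : Pt n),
      fderiv ℝ (unc (dirD w F)) p v = fderiv ℝ (fderiv ℝ (unc F)) p v w := by
    intro v w p
    have : unc (dirD w F) = fun q => fderiv ℝ (unc F) q w := rfl
    rw [this, fderiv_clm_apply (hd p) (differentiableAt_const w)]
    simp
  funext t x y
  change fderiv ℝ (unc (dirD w F)) (t, x, y) v = fderiv ℝ (unc (dirD v F)) (t, x, y) w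
  rw [key, key]
  have hs : IsSymmSndFDerivAt ℝ (unc F) (t, x, y) :=
    h.contDiffAt.isSymmSndFDerivAt (by
      rw [minSmoothness_of_isRCLikeNormedField]; exact WithTop.coe_le_coe.2 le_top)
  exact hs v w

lemma dirD_add (v : Pt n) {F G : Fn n} (hF : Smooth F) (hG : Smooth G) :
    dirD v (F + G) = dirD v F + dirD v G := by
  funext t x y
  have : unc (F + G) = unc F + unc G := rfl
  simp only [dirD, this, Pi.add_apply]
  rw [fderiv_add (hF.differentiable _) (hG.differentiable _)]
  rfl

lemma dirD_mul (v : Pt n) {F G : Fn n} (hF : Smooth F) (hG : Smooth G) :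
    dirD v (F * G) = dirD v F * G + F * dirD v G := by
  funext t x y
  have : unc (F * G) = unc F * unc G := rfl
  simp only [dirD, this, Pi.add_apply, Pi.mul_apply]
  rw [fderiv_mul (hF.differentiable _) (hG.differentiable _)]
  simp [unc]
  ring

/-- The coordinate direction `∂/∂t`. -/
def et : Pt n := (1, 0, 0)

/-- The coordinate direction `∂/∂xⁱ`. -/
def ex (i : Fin n) : Pt n := (0, Pi.single i 1, 0)

/-- The coordinate direction `∂/∂yⁱ`. -/
def ey (i : Fin n) : Pt n := (0, 0, Pi.single i 1)

lemma pt_eq {F : Fn n} (hF : Smooth F) : pt F = dirD et F := by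
  funext t x y
  have hc : HasDerivAt (fun s : ℝ => ((s, x, y) : Pt n)) et t :=
    (hasDerivAt_id t).prodMk ((hasDerivAt_const t x).prodMk (hasDerivAt_const t y))
  exact ((hF.differentiable (t, x, y)).hasFDerivAt.comp_hasDerivAt t hc).deriv

lemma px_eq (i : Fin n) {F : Fn n} (hF : Smooth F) : px i F = dirD (ex i) F := by
  funext t x y
  have hc : HasDerivAt (fun s : ℝ => ((t, Function.update x i s, y) : Pt n)) (ex i) (x i) :=
    (hasDerivAt_const _ t).prodMk
      ((hasDerivAt_update x i (x i)).prodMk (hasDerivAt_const _ y))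
  have hf : HasFDerivAt (unc F) (fderiv ℝ (unc F) (t, x, y)) (t, Function.update x i (x i), y) := by
    rw [Function.update_eq_self]
    exact (hF.differentiable (t, x, y)).hasFDerivAt
  exact (hf.comp_hasDerivAt (x i) hc).deriv

lemma py_eq (i : Fin n) {F : Fn n} (hF : Smooth F) : py i F = dirD (ey i) F := by
  funext t x y
  have hc : HasDerivAt (fun s : ℝ => ((t, x, Function.update y i s) : Pt n)) (ey i) (y i) :=
    (hasDerivAt_const _ t).prodMk
      ((hasDerivAt_const _ x).prodMk (hasDerivAt_update y i (y i)))
  have hf : HasFDerivAt (unc F) (fderiv ℝ (unc F) (t, x, y)) (t, x, Function.update y i (y i)) := by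
    rw [Function.update_eq_self]
    exact (hF.differentiable (t, x, y)).hasFDerivAt
  exact (hf.comp_hasDerivAt (y i) hc).deriv

/-! ### Adapted derivations -/

/-- The operator `A` restricts to the derivation `∂_v − cʳ ∂/∂yʳ` on smooth functions. -/
structure IsAdapted (A : Fn n → Fn n) (v : Pt n) (c : Fin n → Fn n) : Prop where
  smooth_coeff : ∀ r, Smooth (c r)
  eq : ∀ F, Smooth F → A F = dirD v F - ∑ r, c r * dirD (ey r) F

namespace IsAdapted

variable {A B : Fn n → Fn n} {v w : Pt n} {c d : Fin n → Fn n}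

lemma smooth (hA : IsAdapted A v c) {F : Fn n} (hF : Smooth F) : Smooth (A F) := by
  rw [hA.eq F hF]
  exact (smooth_dirD v hF).sub
    (Smooth.sum _ fun r => (hA.smooth_coeff r).mul (smooth_dirD _ hF))

lemma add (hA : IsAdapted A v c) {F G : Fn n} (hF : Smooth F) (hG : Smooth G) :
    A (F + G) = A F + A G := by
  rw [hA.eq _ (hF.add hG), hA.eq _ hF, hA.eq _ hG, dirD_add v hF hG]
  simp_rw [dirD_add _ hF hG, mul_add, sum_add_distrib]
  ring

lemma mul (hA : IsAdapted A v c) {F G : Fn n} (hF : Smooth F) (hG : Smooth G) :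
    A (F * G) = A F * G + F * A G := by
  rw [hA.eq _ (hF.mul hG), hA.eq _ hF, hA.eq _ hG, dirD_mul v hF hG]
  have h : ∑ r, c r * dirD (ey r) (F * G)
      = (∑ r, c r * dirD (ey r) F) * G + F * ∑ r, c r * dirD (ey r) G := by
    rw [sum_mul, mul_sum, ← sum_add_distrib]
    refine sum_congr rfl fun r _ => ?_
    rw [dirD_mul _ hF hG]
    ring
  rw [h]
  ring

lemma zero (hA : IsAdapted A v c) : A 0 = 0 := by
  simpa using hA.add Smooth.zero Smooth.zero

lemma sub (hA : IsAdapted A v c) {F G : Fn n} (hF : Smooth F) (hG : Smooth G) :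
    A (F - G) = A F - A G := by
  rw [eq_sub_iff_add_eq, ← hA.add (hF.sub hG) hG, sub_add_cancel]

lemma sum (hA : IsAdapted A v c) {ι : Type*} (s : Finset ι) {F : ι → Fn n}
    (hF : ∀ i, Smooth (F i)) : A (∑ i ∈ s, F i) = ∑ i ∈ s, A (F i) := by
  classical
  induction s using Finset.induction_on with
  | empty => simpa using hA.zero
  | insert a s ha ih =>
    rw [sum_insert ha, sum_insert ha, hA.add (hF a) (Smooth.sum s hF), ih]

lemma sum_mul (hA : IsAdapted A v c) {F G : Fin n → Fn n} (hF : ∀ i, Smooth (F i))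
    (hG : ∀ i, Smooth (G i)) :
    A (∑ r, F r * G r) = ∑ r, A (F r) * G r + ∑ r, F r * A (G r) := by
  rw [hA.sum _ fun r => (hF r).mul (hG r), ← sum_add_distrib]
  exact sum_congr rfl fun r _ => hA.mul (hF r) (hG r)

/-- The commutator of two adapted derivations is vertical. -/
lemma commutator (hA : IsAdapted A v c) (hB : IsAdapted B w d) {F : Fn n} (hF : Smooth F) :
    A (B F) - B (A F) = -∑ r, (A (d r) - B (c r)) * py r F := by
  have expand : ∀ {A B : Fn n → Fn n} {v w : Pt n} {c d : Fin n → Fn n},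
      IsAdapted A v c → IsAdapted B w d →
      A (B F) = dirD v (dirD w F) - ∑ r, c r * dirD (ey r) (dirD w F)
        - ∑ r, d r * dirD (ey r) (dirD v F)
        + ∑ r, ∑ s, d r * (c s * dirD (ey s) (dirD (ey r) F))
        - ∑ r, A (d r) * dirD (ey r) F := by
    intro A B v w c d hA hB
    rw [hB.eq F hF, hA.sub (smooth_dirD w hF)
      (Smooth.sum _ fun r => (hB.smooth_coeff r).mul (smooth_dirD _ hF)),
      hA.sum_mul hB.smooth_coeff (fun r => smooth_dirD _ hF), hA.eq _ (smooth_dirD w hF)]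
    have h : ∑ r, d r * A (dirD (ey r) F)
        = ∑ r, d r * dirD (ey r) (dirD v F)
          - ∑ r, ∑ s, d r * (c s * dirD (ey s) (dirD (ey r) F)) := by
      rw [← sum_sub_distrib]
      refine sum_congr rfl fun r _ => ?_
      rw [hA.eq _ (smooth_dirD _ hF), mul_sub, mul_sum, dirD_comm v _ hF]
    rw [h]
    ring
  have hsymm : ∑ r, ∑ s, d r * (c s * dirD (ey s) (dirD (ey r) F))
      = ∑ r, ∑ s, c r * (d s * dirD (ey s) (dirD (ey r) F)) := by
    rw [sum_comm]
    refine sum_congr rfl fun r _ => sum_congr rfl fun s _ => ?_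
    rw [dirD_comm (ey r) (ey s) hF]
    ring
  rw [expand hA hB, expand hB hA, hsymm, dirD_comm v w hF]
  simp_rw [py_eq _ hF, sub_mul, sum_sub_distrib]
  ring

end IsAdapted

lemma isAdapted_dt {M : Fin n → Fn n} (hM : ∀ i, Smooth (M i)) : IsAdapted (dt M) et M where
  smooth_coeff := hM
  eq F hF := by simp_rw [dt, pt_eq hF, py_eq _ hF]

lemma isAdapted_dx {N : Fin n → Fin n → Fn n} (hN : ∀ i j, Smooth (N i j)) (k : Fin n) :
    IsAdapted (dx N k) (ex k) (fun r => N r k) where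
  smooth_coeff r := hN r k
  eq F hF := by simp_rw [dx, px_eq k hF, py_eq _ hF]

lemma isAdapted_py (k : Fin n) : IsAdapted (py k) (ey k) 0 where
  smooth_coeff _ := Smooth.zero
  eq F hF := by simp [py_eq k hF]

/-! ### The general Ricci identity -/

/-- The covariant derivative of a vector field along an operator `A` with connection
coefficients `a`. -/
def cov (A : Fn n → Fn n) (a : Fin n → Fin n → Fn n) (X : Fin n → Fn n) (i : Fin n) : Fn n :=
  A (X i) + ∑ r, X r * a i r

lemma cov_commutator {A B : Fn n → Fn n} {v w : Pt n} {c d : Fin n → Fn n}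
    (hA : IsAdapted A v c) (hB : IsAdapted B w d) {a b : Fin n → Fin n → Fn n}
    (ha : ∀ i r, Smooth (a i r)) (hb : ∀ i r, Smooth (b i r))
    {X : Fin n → Fn n} (hX : ∀ i, Smooth (X i)) (i : Fin n) :
    cov A a (cov B b X) i - cov B b (cov A a X) i
      = ∑ r, X r * (A (b i r) - B (a i r) + ∑ s, b s r * a i s - ∑ s, a s r * b i s)
        - ∑ r, py r (X i) * (A (d r) - B (c r)) := by
  have expand : ∀ {A B : Fn n → Fn n} {v w : Pt n} {c d : Fin n → Fn n}
      {a b : Fin n → Fin n → Fn n}, IsAdapted A v c → IsAdapted B w d →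
      (∀ i r, Smooth (b i r)) →
      cov A a (cov B b X) i = A (B (X i)) + ∑ r, A (X r) * b i r + ∑ r, X r * A (b i r)
        + ∑ r, B (X r) * a i r + ∑ r, X r * ∑ s, b s r * a i s := by
    intro A B v w c d a b hA hB hb
    have h : ∑ r, (∑ s, X s * b r s) * a i r = ∑ r, X r * ∑ s, b s r * a i s := by
      simp_rw [sum_mul, mul_sum]
      rw [sum_comm]
      simp_rw [mul_assoc]
    simp only [cov, add_mul, sum_add_distrib]
    rw [hA.add (hB.smooth (hX i)) (Smooth.sum _ fun r => (hX r).mul (hb i r)),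
      hA.sum_mul hX (hb i), h]
    ring
  have hcomm := hA.commutator hB (hX i)
  have hsum : ∑ r, (A (d r) - B (c r)) * py r (X i) = ∑ r, py r (X i) * (A (d r) - B (c r)) :=
    sum_congr rfl fun r _ => mul_comm _ _
  rw [hsum] at hcomm
  simp only [mul_sub, sum_sub_distrib] at hcomm
  rw [expand hA hB hb, expand hB hA ha]
  simp_rw [mul_sub, mul_add, mul_sub, sum_sub_distrib, sum_add_distrib, sum_sub_distrib]
  linear_combination hcomm

/-! ### Covariant derivatives in terms of `cov` -/

lemma covT_sigU (M : Fin n → Fn n) (Γ : Conn n) (X : Fin n → Fn n) (a : Fin 1 → Fin n) :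
    covT M Γ 0 sigU (famT X) a = cov (dt M) Γ.G X (a 0) := by
  simp [covT, sigU, famT, cov]

lemma covX_sigU (N : Fin n → Fin n → Fn n) (Γ : Conn n) (k : Fin n) (X : Fin n → Fn n)
    (a : Fin 1 → Fin n) :
    covX N Γ sigU k (famT X) a = cov (dx N k) (fun i r => Γ.L i r k) X (a 0) := by
  simp [covX, sigU, famT, cov]

lemma covY_sigU (Γ : Conn n) (k : Fin n) (X : Fin n → Fn n) (a : Fin 1 → Fin n) :
    covY Γ sigU k (famT X) a = cov (py k) (fun i r => Γ.C i r k) X (a 0) := by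
  simp [covY, sigU, famT, cov]

lemma covT_sigU_eq_famT (M : Fin n → Fn n) (Γ : Conn n) (X : Fin n → Fn n) :
    covT M Γ 0 sigU (famT X) = famT (cov (dt M) Γ.G X) :=
  funext fun a => covT_sigU M Γ X a

lemma covT_sigUlS (M : Fin n → Fn n) (Γ : Conn n) (E : Fin n → Fin n → Fn n) (i j : Fin n) :
    covT M Γ 0 sigUlS (fun a => E (a 0) (a 1)) ![i, j]
      = cov (dt M) Γ.G (fun i => E i j) i - ∑ r, E i r * Γ.G r j := by
  simp [covT, sigUlS, cov, Fin.sum_univ_succ]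
  ring

lemma covT_sigUlV (M : Fin n → Fn n) (Γ : Conn n) (E : Fin n → Fin n → Fn n) (i j : Fin n) :
    covT M Γ 0 sigUlV (fun a => E (a 0) (a 1)) ![i, j]
      = cov (dt M) Γ.G (fun i => E i j) i - ∑ r, E i r * (Γ.G r j - kron r j * Γ.κ) := by
  simp [covT, sigUlV, cov, Fin.sum_univ_succ]
  ring

lemma covX_sigUlS (N : Fin n → Fin n → Fn n) (Γ : Conn n) (E : Fin n → Fin n → Fn n)
    (i j k : Fin n) :
    covX N Γ sigUlS k (fun a => E (a 0) (a 1)) ![i, j]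
      = cov (dx N k) (fun i r => Γ.L i r k) (fun i => E i j) i - ∑ r, E i r * Γ.L r j k := by
  simp [covX, sigUlS, cov, Fin.sum_univ_succ]
  ring

lemma covX_sigUlV (N : Fin n → Fin n → Fn n) (Γ : Conn n) (E : Fin n → Fin n → Fn n)
    (i j k : Fin n) :
    covX N Γ sigUlV k (fun a => E (a 0) (a 1)) ![i, j]
      = cov (dx N k) (fun i r => Γ.L i r k) (fun i => E i j) i - ∑ r, E i r * Γ.L r j k := by
  simp [covX, sigUlV, cov, Fin.sum_univ_succ]
  ring

lemma covY_sigUlS (Γ : Conn n) (E : Fin n → Fin n → Fn n) (i j k : Fin n) :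
    covY Γ sigUlS k (fun a => E (a 0) (a 1)) ![i, j]
      = cov (py k) (fun i r => Γ.C i r k) (fun i => E i j) i - ∑ r, E i r * Γ.C r j k := by
  simp [covY, sigUlS, cov, Fin.sum_univ_succ]
  ring

lemma covY_sigUlV (Γ : Conn n) (E : Fin n → Fin n → Fn n) (i j k : Fin n) :
    covY Γ sigUlV k (fun a => E (a 0) (a 1)) ![i, j]
      = cov (py k) (fun i r => Γ.C i r k) (fun i => E i j) i - ∑ r, E i r * Γ.C r j k := by
  simp [covY, sigUlV, cov, Fin.sum_univ_succ]
  ring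

lemma covT_CT (M : Fin n → Fn n) (Γ : Conn n) (l i k : Fin n) :
    covT M Γ 0 sigC (CT Γ) ![l, i, k]
      = dt M (Γ.C l i k) + ∑ r, Γ.C r i k * Γ.G l r - ∑ r, Γ.G r i * Γ.C l r k
        - ∑ r, Γ.C l i r * (Γ.G r k - kron r k * Γ.κ) := by
  simp [covT, sigC, CT, Fin.sum_univ_succ, mul_comm (Γ.G _ i)]
  ring

lemma covX_CT (N : Fin n → Fin n → Fn n) (Γ : Conn n) (l i j k : Fin n) :
    covX N Γ sigC j (CT Γ) ![l, i, k]
      = dx N j (Γ.C l i k) + ∑ r, Γ.C r i k * Γ.L l r j - ∑ r, Γ.L r i j * Γ.C l r k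
        - ∑ r, Γ.C l i r * Γ.L r k j := by
  simp [covX, sigC, CT, Fin.sum_univ_succ, mul_comm (Γ.L _ i j)]
  ring

/-- Contraction of the vertical covariant derivative of a vector field with `ρ`. -/
lemma sum_cov_py_mul (Γ : Conn n) (X ρ : Fin n → Fn n) (i : Fin n) :
    ∑ r, cov (py r) (fun i s => Γ.C i s r) X i * ρ r
      = ∑ r, py r (X i) * ρ r + ∑ r, X r * ∑ s, Γ.C i r s * ρ s := by
  simp only [cov, add_mul, sum_add_distrib, sum_mul, mul_sum]
  rw [sum_comm (f := fun r s => X s * Γ.C i s r * ρ r)]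
  simp_rw [mul_assoc]

end Jet

namespace Jet

/-- local Ricci identities for a d-tensor `Xⁱ` with a single upper spatial
index, for an `h`-normal Γ-linear connection of Cartan type. -/
theorem ricci_identities_upper_spatial
    (n : ℕ) (hn : 1 ≤ n)
    (h : ℝ → ℝ) (hh : ContDiff ℝ (⊤ : ℕ∞) h) (hhpos : ∀ t, 0 < h t)
    (M : Fin n → Fn n) (N : Fin n → Fin n → Fn n) (Γ : Conn n)
    (hκ : Γ.κ = chr h)
    (hMs : ∀ i, Smooth (M i)) (hNs : ∀ i j, Smooth (N i j))
    (hGs : ∀ k i, Smooth (Γ.G k i)) (hLs : ∀ k i j, Smooth (Γ.L k i j))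
    (hCs : ∀ k i j, Smooth (Γ.C k i j))
    (hLsym : ∀ k i j, Γ.L k i j = Γ.L k j i) (hCsym : ∀ k i j, Γ.C k i j = Γ.C k j i)
    (X : Fin n → Fn n) (hX : ∀ i, Smooth (X i)) :
    (∀ i k, covX N Γ sigU k (covT M Γ 0 sigU (famT X)) ![i]
        - covT M Γ 0 sigUlS (fun a => covX N Γ sigU (a 1) (famT X) ![a 0]) ![i, k]
      = (∑ r, X r * Rc1 M N Γ i r k)
        - (∑ r, (covX N Γ sigU r (famT X) ![i]) * T1 Γ r k)
        - (∑ r, (covY Γ sigU r (famT X) ![i]) * Rv1 M N r k))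
    ∧ (∀ i j k, covX N Γ sigUlS k (fun a => covX N Γ sigU (a 1) (famT X) ![a 0]) ![i, j]
        - covX N Γ sigUlS j (fun a => covX N Γ sigU (a 1) (famT X) ![a 0]) ![i, k]
      = (∑ r, X r * Rc M N Γ i r j k)
        - (∑ r, (covY Γ sigU r (famT X) ![i]) * Rvsp M N r j k))
    ∧ (∀ i k, covY Γ sigU k (covT M Γ 0 sigU (famT X)) ![i]
        - covT M Γ 0 sigUlV (fun a => covY Γ sigU (a 1) (famT X) ![a 0]) ![i, k]
      = (∑ r, X r * Pc1 M N Γ i r k)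
        - (∑ r, (covY Γ sigU r (famT X) ![i]) * Pv1 M Γ r k))
    ∧ (∀ i j k, covY Γ sigUlS k (fun a => covX N Γ sigU (a 1) (famT X) ![a 0]) ![i, j]
        - covX N Γ sigUlV j (fun a => covY Γ sigU (a 1) (famT X) ![a 0]) ![i, k]
      = (∑ r, X r * Pc M N Γ i r j k)
        - (∑ r, (covX N Γ sigU r (famT X) ![i]) * Γ.C r j k)
        - (∑ r, (covY Γ sigU r (famT X) ![i]) * Pvsp N Γ r j k))
    ∧ (∀ i j k, covY Γ sigUlV k (fun a => covY Γ sigU (a 1) (famT X) ![a 0]) ![i, j]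
        - covY Γ sigUlV j (fun a => covY Γ sigU (a 1) (famT X) ![a 0]) ![i, k]
      = (∑ r, X r * Sc Γ i r j k)) := by
  have hdt := isAdapted_dt hMs
  have hdx := fun k => isAdapted_dx hNs k
  have hpy := fun k => isAdapted_py (n := n) k
  have hLk := fun k i r => hLs i r k
  have hCk := fun k i r => hCs i r k
  simp only [covT_sigU_eq_famT, covX_sigU, covY_sigU, Matrix.cons_val_zero]
  refine ⟨fun i k => ?_, fun i j k => ?_, fun i k => ?_, fun i j k => ?_, fun i j k => ?_⟩
  · rw [covT_sigUlS M Γ (fun i k => cov (dx N k) (fun i r => Γ.L i r k) X i), sum_cov_py_mul]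
    have key := cov_commutator (hdx k) hdt (hLk k) hGs hX i
    simp only [Rc1, T1, Rv1, mul_add, mul_sub, mul_neg, sum_add_distrib, sum_sub_distrib,
      sum_neg_distrib] at key ⊢
    linear_combination key
  · rw [covX_sigUlS N Γ (fun i k => cov (dx N k) (fun i r => Γ.L i r k) X i),
      covX_sigUlS N Γ (fun i k => cov (dx N k) (fun i r => Γ.L i r k) X i), sum_cov_py_mul]
    have key := cov_commutator (hdx k) (hdx j) (hLk k) (hLk j) hX i
    simp only [hLsym _ k j]
    simp only [Rc, Rvsp, mul_add, mul_sub, sum_add_distrib, sum_sub_distrib] at key ⊢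
    linear_combination key
  · rw [covT_sigUlV M Γ (fun i k => cov (py k) (fun i r => Γ.C i r k) X i), sum_cov_py_mul,
      sum_cov_py_mul]
    have key := cov_commutator (hpy k) hdt (hCk k) hGs hX i
    simp only [Pc1, Pv1, covT_CT, Pi.zero_apply, hdt.zero, sub_zero, mul_add, mul_sub,
      sum_add_distrib, sum_sub_distrib] at key ⊢
    linear_combination key
  · rw [covY_sigUlS Γ (fun i k => cov (dx N k) (fun i r => Γ.L i r k) X i),
      covX_sigUlV N Γ (fun i k => cov (py k) (fun i r => Γ.C i r k) X i), sum_cov_py_mul,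
      sum_cov_py_mul]
    have key := cov_commutator (hpy k) (hdx j) (hCk k) (hLk j) hX i
    simp only [Pc, Pvsp, covX_CT, Pi.zero_apply, (hdx j).zero, sub_zero, mul_add, mul_sub,
      sum_add_distrib, sum_sub_distrib] at key ⊢
    linear_combination key
  · rw [covY_sigUlV Γ (fun i k => cov (py k) (fun i r => Γ.C i r k) X i),
      covY_sigUlV Γ (fun i k => cov (py k) (fun i r => Γ.C i r k) X i)]
    have key := cov_commutator (hpy k) (hpy j) (hCk k) (hCk j) hX i
    simp only [hCsym _ k j]
    simp only [Sc, Pi.zero_apply, (hpy j).zero, (hpy k).zero, sub_zero, mul_zero,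
      sum_const_zero, mul_add, mul_sub, sum_add_distrib, sum_sub_distrib] at key ⊢
    linear_combination key

end Jet
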